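/- Let F_0 = (V, E_0) be a forest with n = |V| vertices and m = |E_0| edges, let p be an integer with 1 ≤ p ≤ n − 1, and let F_i = (V, E_i), 0 ≤ i ≤ l, be a sequence of forests with E_i ⊆ E_{i−1} and |E_i| = |E_{i−1}| − p for 1 ≤ i ≤ l. If m > n·(p−1)/p, then every forest F_i with index i < (1/p)·(m − n·(p−1)/p) contains a connected component (tree) with at least p edges. -/

import Mathlib

/-- The edges of the connected component `C` of a graph `G`:
edges of `G` all of whose endpoints belong to `C`. -/
def componentEdges {V : Type*} (G : SimpleGraph V) (C : G.ConnectedComponent) : Set (Sym2 V) :=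
  {e | e ∈ G.edgeSet ∧ ∀ v ∈ e, G.connectedComponentMk v = C}

theorem comp_card {V : Type*} [Fintype V] (G : SimpleGraph V) (hG : G.IsAcyclic)
    (C : G.ConnectedComponent) : (componentEdges G C).ncard + 1 ≤ C.supp.ncard := by
  classical
  have hT := (hG.isTree_connectedComponent C).card_edgeFinset
  have hsub : componentEdges G C ⊆
      (Sym2.map (Subtype.val : C → V)) '' C.toSimpleGraph.edgeSet := by
    rintro e ⟨he, hv⟩
    induction e using Sym2.ind with
    | _ a b =>
      have ha : a ∈ C := hv a (by simp)
      have hb : b ∈ C := hv b (by simp)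
      refine ⟨s(⟨a, ha⟩, ⟨b, hb⟩), ?_, by simp⟩
      exact (C.toSimpleGraph_adj ha hb).2 he
  have h1 := Set.ncard_le_ncard hsub (Set.toFinite _)
  have h2 := Set.ncard_image_le (f := Sym2.map (Subtype.val : C → V))
    (Set.toFinite C.toSimpleGraph.edgeSet)
  have h3 : C.toSimpleGraph.edgeSet.ncard = C.toSimpleGraph.edgeFinset.card := by
    rw [← SimpleGraph.coe_edgeFinset, Set.ncard_coe_finset]
  have h4 : C.supp.ncard = Fintype.card C := by
    rw [← Nat.card_coe_set_eq, ← Nat.card_eq_fintype_card]; rfl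
  omega

theorem small_comps {V : Type*} [Fintype V] (G : SimpleGraph V) (hG : G.IsAcyclic) (p : ℕ)
    (h : ∀ C : G.ConnectedComponent, (componentEdges G C).ncard < p) :
    p * G.edgeSet.ncard ≤ (p - 1) * Fintype.card V := by
  classical
  have hE : G.edgeSet.ncard ≤ ∑ C : G.ConnectedComponent, (componentEdges G C).ncard := by
    have hU : G.edgeSet ⊆ ⋃ C : G.ConnectedComponent, componentEdges G C := by
      intro e he
      induction e using Sym2.ind with
      | _ a b =>
        refine Set.mem_iUnion.2 ⟨G.connectedComponentMk a, he, ?_⟩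
        intro v hv
        rcases Sym2.mem_iff.1 hv with rfl | rfl
        · rfl
        · exact SimpleGraph.ConnectedComponent.sound
            (SimpleGraph.Adj.reachable (G.mem_edgeSet.1 he)).symm
    exact (Set.ncard_le_ncard hU (Set.toFinite _)).trans (Set.ncard_iUnion_le_of_fintype _)
  have hV : ∑ C : G.ConnectedComponent, C.supp.ncard = Fintype.card V := by
    rw [← Finset.card_univ, Finset.card_eq_sum_card_fiberwise
      (f := G.connectedComponentMk) (t := Finset.univ) (by simp)]
    refine Finset.sum_congr rfl fun C _ => ?_
    rw [← Set.ncard_coe_finset]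
    congr 1
    ext v
    simp
  calc p * G.edgeSet.ncard ≤ p * ∑ C : G.ConnectedComponent, (componentEdges G C).ncard :=
        Nat.mul_le_mul_left _ hE
    _ = ∑ C : G.ConnectedComponent, p * (componentEdges G C).ncard := Finset.mul_sum _ _ _
    _ ≤ ∑ C : G.ConnectedComponent, (p - 1) * C.supp.ncard := by
        refine Finset.sum_le_sum fun C _ => ?_
        have h1 := comp_card G hG C
        have h2 := h C
        obtain ⟨q, rfl⟩ : ∃ q, p = q + 1 := ⟨p - 1, by omega⟩
        simp only [Nat.add_sub_cancel]
        nlinarith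
    _ = (p - 1) * Fintype.card V := by rw [← Finset.mul_sum, hV]

/-- Let `F 0` be a forest with `n` vertices and `m` edges, `1 ≤ p ≤ n − 1`,
and let `F i`, `0 ≤ i ≤ l`, be a sequence of forests with `E_i ⊆ E_{i−1}` and
`|E_i| = |E_{i−1}| − p`. If `m > n·(p−1)/p`, then every forest `F i` with index
`i < (1/p)·(m − n·(p−1)/p)` contains a connected component with at least `p` edges. -/
theorem forest_sequence_has_large_tree {V : Type*} [Fintype V] (p l : ℕ)
    (hp1 : 1 ≤ p) (hp2 : p ≤ Fintype.card V - 1)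
    (F : ℕ → SimpleGraph V) (hforest : ∀ i ≤ l, (F i).IsAcyclic)
    (hsub : ∀ i < l, F (i + 1) ≤ F i)
    (hcard : ∀ i < l, (F i).edgeSet.ncard = (F (i + 1)).edgeSet.ncard + p)
    (hm : (Fintype.card V : ℚ) * ((p : ℚ) - 1) / (p : ℚ) < ((F 0).edgeSet.ncard : ℚ)) :
    ∀ i ≤ l,
      (i : ℚ) < (1 / (p : ℚ)) *
        (((F 0).edgeSet.ncard : ℚ) - (Fintype.card V : ℚ) * ((p : ℚ) - 1) / (p : ℚ)) →
      ∃ C : (F i).ConnectedComponent, p ≤ (componentEdges (F i) C).ncard := by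
  intro i hi hlt
  by_contra! hno
  have hs := small_comps (F i) (hforest i hi) p hno
  have hE : ∀ j ≤ l, (F 0).edgeSet.ncard = (F j).edgeSet.ncard + j * p := by
    intro j
    induction j with
    | zero => simp
    | succ j ih =>
      intro hj
      rw [ih (by omega), hcard j (by omega)]
      ring
  have hEi : ((F 0).edgeSet.ncard : ℚ) = (F i).edgeSet.ncard + i * p := by
    exact_mod_cast hE i hi
  have hs' : (p : ℚ) * (F i).edgeSet.ncard ≤ ((p : ℚ) - 1) * Fintype.card V := by
    have : ((p - 1 : ℕ) : ℚ) = (p : ℚ) - 1 := by push_cast [hp1]; ring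
    rw [← this]
    exact_mod_cast hs
  have hp : (0 : ℚ) < p := by exact_mod_cast hp1
  rw [hEi, one_div, inv_mul_eq_div, lt_div_iff₀ hp] at hlt
  have h5 : (Fintype.card V : ℚ) * ((p : ℚ) - 1) / p < (F i).edgeSet.ncard := by linarith
  rw [div_lt_iff₀ hp] at h5
  linarith
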